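/- Let q be an odd prime power, let m ≡ 2 (mod 4) with m ≥ 2, and let n = q^m + 1. Let δ be an integer. If δ_{3,n} + 1 ≤ δ ≤ δ_{2,n}, then the union C_1 ∪ C_2 ∪ ... ∪ C_{δ-1} of q-cyclotomic cosets modulo n has cardinality n - 6 (equivalently, the narrow-sense BCH code C_{(n,q,δ,1)} has dimension 6 and C_{(n,q,δ+1,0)} has dimension 5). If δ_{4,n} + 1 ≤ δ ≤ δ_{3,n}, then C_1 ∪ C_2 ∪ ... ∪ C_{δ-1} has cardinality n - (2m+6) (equivalently, C_{(n,q,δ,1)} has dimension 2m+6 and C_{(n,q,δ+1,0)} has dimension 2m+5). -/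

import Mathlib

/-- The `q`-cyclotomic coset of `s` modulo `n`:
`C_s = { s·q^j mod n : 0 ≤ j ≤ ord_n(q) - 1 }`. -/
noncomputable def cycCoset (q n s : ℕ) : Finset ℕ :=
  (Finset.range (orderOf (q : ZMod n))).image fun j => s * q ^ j % n

/-- `s` is a coset leader modulo `n` iff `s = min C_s`. -/
def IsCosetLeader (q n s : ℕ) : Prop :=
  s ∈ cycCoset q n s ∧ ∀ x ∈ cycCoset q n s, s ≤ x

/-- The set of coset leaders modulo `n` (as a finset of `{0, …, n-1}`). -/
noncomputable def cosetLeaders (q n : ℕ) : Finset ℕ :=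
  (Finset.range n).filter fun s => s ∈ cycCoset q n s ∧ ∀ x ∈ cycCoset q n s, s ≤ x

/-- The `i`-th largest coset leader modulo `n` (for `i ≥ 1`), i.e. `δ_{i,n}`. -/
noncomputable def nthLargestCosetLeader (q n i : ℕ) : ℕ :=
  (((cosetLeaders q n).sort (· ≤ ·)).reverse).getD (i - 1) 0


/-- distance to the nearest multiple of `n` -/
def nrm (n x : ℤ) : ℤ := min (x % n) (n - x % n)

lemma nrm_nonneg {n : ℤ} (hn : 0 < n) (x : ℤ) : 0 ≤ nrm n x := by
  have h1 := Int.emod_nonneg x hn.ne'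
  have h2 := Int.emod_lt_of_pos x hn
  unfold nrm; omega

lemma two_nrm_le {n : ℤ} (x : ℤ) : 2 * nrm n x ≤ n := by
  unfold nrm; omega

lemma nrm_dvd (n x : ℤ) : n ∣ x - nrm n x ∨ n ∣ x + nrm n x := by
  have h3 := Int.emod_add_mul_ediv x n
  unfold nrm
  rcases min_choice (x % n) (n - x % n) with h | h <;> rw [h]
  · left; exact ⟨x / n, by linarith⟩
  · right; exact ⟨x / n + 1, by linarith⟩

lemma nrm_eq {n x z : ℤ} (hn : 0 < n) (h0 : 0 ≤ z) (h1 : 2 * z ≤ n)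
    (h : n ∣ x - z ∨ n ∣ x + z) : nrm n x = z := by
  unfold nrm
  rcases h with ⟨c, hc⟩ | ⟨c, hc⟩
  · have : x % n = z := by
      have hx : x = z + n * c := by linarith
      rw [hx, Int.add_mul_emod_self_left, Int.emod_eq_of_lt h0 (by linarith)]
    rw [this]; omega
  · rcases h0.eq_or_lt with h0 | h0
    · subst h0
      have hx : x = n * c := by linarith
      rw [hx, Int.mul_emod_right]; omega
    · have : x % n = n - z := by
        have hx : x = (n - z) + n * (c - 1) := by linarith
        rw [hx, Int.add_mul_emod_self_left, Int.emod_eq_of_lt (by linarith) (by linarith)]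
      rw [this]; omega

lemma nrm_zero_dvd {n x : ℤ} (h : nrm n x = 0) : n ∣ x := by
  rcases nrm_dvd n x with h1 | h1 <;> simpa [h] using h1

/-- one step of the orbit -/
lemma nrm_step {n q x c : ℤ} (hn : 0 < n) (hq : 0 < q) (hc : q * c < n)
    (h1 : nrm n x ≤ c) :
    nrm n (q * x) = q * nrm n x ∨ nrm n (q * x) = n - q * nrm n x := by
  have a1 := nrm_nonneg hn x
  have b1 := nrm_nonneg hn (q * x)
  have b2 := two_nrm_le (n := n) (q * x)
  have hlt : q * nrm n x < n := lt_of_le_of_lt (by nlinarith) hc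
  have hge : 0 ≤ q * nrm n x := by positivity
  have key : n ∣ q * nrm n x - nrm n (q * x) ∨ n ∣ q * nrm n x + nrm n (q * x) := by
    rcases nrm_dvd n x with ⟨c, hc⟩ | ⟨c, hc⟩ <;> rcases nrm_dvd n (q * x) with ⟨d, hd⟩ | ⟨d, hd⟩
    · left; exact ⟨d - q * c, by linear_combination hd - q * hc⟩
    · right; exact ⟨d - q * c, by linear_combination hd - q * hc⟩
    · right; exact ⟨q * c - d, by linear_combination q * hc - hd⟩
    · left; exact ⟨q * c - d, by linear_combination q * hc - hd⟩
  rcases key with ⟨e, he⟩ | ⟨e, he⟩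
  · left
    have : e = 0 := by
      have : -1 < e := by by_contra hh; nlinarith
      have : e < 1 := by by_contra hh; nlinarith
      omega
    subst this; linarith
  · have : -1 < e := by by_contra hh; nlinarith
    have : e < 2 := by by_contra hh; nlinarith
    have : e = 0 ∨ e = 1 := by omega
    rcases this with rfl | rfl
    · left; linarith
    · right; linarith

/-- The renormalised dynamics. -/
lemma U_core (Q p : ℤ) (hQ : 9 ≤ Q) (hp : 0 < p) (hp' : 2 * p < Q ^ 3 - 1) (k : ℕ) (hk : 3 ≤ k) (hko : Odd k)
    (U : ℕ → ℤ)
    (hstep : ∀ j, U (j + 1) = -Q * U j ∨ U (j + 1) = Q * U j + p * (1 + Q ^ k))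
    (hle : ∀ j, U j ≤ p * (1 + Q ^ (k - 2)))
    (hper : ∀ j, U (j + k) = U j)
    (hinc : ∀ j, U j < Q * U j + p * (1 + Q ^ k)) :
    U 0 = 0 ∨ ∃ i, U i = p * (1 + Q ^ (k - 2)) := by
  classical
  have hQk : Q ^ k = Q ^ (k - 2) * Q ^ 2 := by
    rw [← pow_add]; congr 1; omega
  have hX : 0 < Q ^ (k - 2) := by positivity
  -- global lower bound
  have hmin : ∀ j, -Q * (p * (1 + Q ^ (k - 2))) ≤ U j := by
    obtain ⟨i, -, hi⟩ := Finset.exists_min_image (Finset.range k) U ⟨0, by simp; omega⟩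
    have hmod : ∀ j, U j = U (j % k) := by
      intro j
      induction j using Nat.strong_induction_on with
      | _ j ih =>
        rcases lt_or_ge j k with h | h
        · rw [Nat.mod_eq_of_lt h]
        · obtain ⟨l, rfl⟩ := Nat.exists_eq_add_of_le' h
          rw [hper, ih l (by omega), Nat.add_mod_right]
    have hi' : ∀ j, U i ≤ U j := fun j => by
      rw [hmod j]; exact hi _ (by simp; exact Nat.mod_lt _ (by omega))
    intro j
    refine le_trans ?_ (hi' j)
    have e : U (i + k - 1 + 1) = U i := by
      rw [show i + k - 1 + 1 = i + k by omega, hper]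
    rcases hstep (i + k - 1) with h | h
    · have := hle (i + k - 1)
      rw [← e, h]; nlinarith
    · have := hinc (i + k - 1)
      rw [← h, e] at this
      exact absurd (hi' (i + k - 1)) (not_le.mpr this)
  let L : ℕ → Prop := fun j => U (j + 1) = Q * U j + p * (1 + Q ^ k)
  have hR : ∀ j, ¬ L j → U (j + 1) = -Q * U j := fun j h => (hstep j).resolve_right h
  have hrun : ∀ i a, (∀ l, l < a → ¬ L (i + l)) → U (i + a) = (-Q) ^ a * U i := by
    intro i a
    induction a with
    | zero => simp
    | succ a ih =>
      intro h
      rw [← add_assoc, hR _ (h a (by omega)), ih (fun l hl => h l (by omega))]; ring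
  by_cases hall : ∀ j, ¬ L j
  · left
    have h := hrun 0 k (fun l _ => hall _)
    rw [hper, hko.neg_pow] at h
    have : (0 : ℤ) < Q ^ k := by positivity
    have h2 : (1 + Q ^ k) * U 0 = 0 := by linarith
    rcases mul_eq_zero.mp h2 with h3 | h3
    · linarith
    · exact h3
  right
  push Not at hall
  obtain ⟨i0, hi0⟩ := hall
  have hLper : ∀ j, L (j + k) ↔ L j := by
    intro j
    simp only [L]
    rw [show j + k + 1 = (j + 1) + k by ring, hper, hper]
  -- last L of the same parity
  let S := (Finset.Icc i0 (i0 + k)).filter (fun j => L j ∧ j % 2 = i0 % 2)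
  have hS : S.Nonempty := ⟨i0, by simp [S, hi0]⟩
  obtain ⟨i, hiS, hi⟩ := Finset.exists_max_image S id hS
  simp only [S, Finset.mem_filter, Finset.mem_Icc, id] at hiS hi
  obtain ⟨⟨hi1, hi2⟩, hLi, hpar⟩ := hiS
  have hko' : k % 2 = 1 := Nat.odd_iff.mp hko
  have hex : ∃ a, L (i + 1 + a) := ⟨i0 + k - (i + 1), by
    rw [show i + 1 + (i0 + k - (i + 1)) = i0 + k by omega]; exact (hLper i0).mpr hi0⟩
  obtain ⟨a, ha, hamin⟩ : ∃ a, L (i + 1 + a) ∧ ∀ b, b < a → ¬ L (i + 1 + b) :=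
    ⟨Nat.find hex, Nat.find_spec hex, fun b hb => Nat.find_min hex hb⟩
  have hale : i + 1 + a ≤ i0 + k := by
    by_contra hh
    apply hamin (i0 + k - (i + 1)) (by omega)
    rw [show i + 1 + (i0 + k - (i + 1)) = i0 + k by omega]; exact (hLper i0).mpr hi0
  have hodd : a % 2 = 0 := by
    by_contra hh
    have := hi (i + 1 + a) ⟨⟨by omega, hale⟩, ha, by omega⟩
    omega
  have hru := hrun (i + 1) a hamin
  have hae : Even a := Nat.even_iff.mpr hodd
  rw [hae.neg_pow] at hru
  have hLi' : U (i + 1) = Q * U i + p * (1 + Q ^ k) := hLi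
  have ha' : U (i + 1 + a + 1) = Q * U (i + 1 + a) + p * (1 + Q ^ k) := ha
  have hb := hle (i + 1 + a + 1)
  have hQa : 0 < Q ^ a := by positivity
  have hmi := hmin i
  have hlow : p * (1 - Q ^ 2) ≤ U (i + 1) := by
    rw [hLi', hQk]
    have := mul_le_mul_of_nonneg_left hmi (show (0:ℤ) ≤ Q by linarith)
    nlinarith
  have hineq : Q ^ (a + 1) * (p * (1 - Q ^ 2)) + p * (1 + Q ^ k) ≤ p * (1 + Q ^ (k - 2)) := by
    rw [ha', hru] at hb
    have h1 := mul_le_mul_of_nonneg_left hlow (show (0:ℤ) ≤ Q ^ (a + 1) by positivity)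
    have h2 : Q ^ (a + 1) = Q * Q ^ a := by ring
    rw [h2] at h1 ⊢
    linarith
  have hcmp : Q ^ (k - 2) ≤ Q ^ (a + 1) := by
    rw [hQk] at hineq
    have h2 : p * (Q ^ 2 - 1) * Q ^ (k - 2) ≤ p * (Q ^ 2 - 1) * Q ^ (a + 1) := by linarith
    exact le_of_mul_le_mul_left h2 (mul_pos hp (by nlinarith))
  have hge : k - 2 ≤ a + 1 := (pow_le_pow_iff_right₀ (by linarith)).mp hcmp
  have hcase : a + 1 = k - 2 ∨ a + 1 = k := by omega
  rcases hcase with hc | hc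
  · -- equality
    rw [ha', hru] at hb
    have h2 : Q ^ (k - 2) = Q * Q ^ a := by rw [← hc]; ring
    have hup : U (i + 1) ≤ p * (1 - Q ^ 2) := by
      have : (Q * Q ^ a) * U (i + 1) ≤ (Q * Q ^ a) * (p * (1 - Q ^ 2)) := by
        rw [hQk, h2] at hb
        linarith
      exact le_of_mul_le_mul_left this (by positivity)
    have heq : U (i + 1) = p * (1 - Q ^ 2) := le_antisymm hup hlow
    have hUi : U i = -Q * (p * (1 + Q ^ (k - 2))) := by
      have : Q * U i = Q * (-Q * (p * (1 + Q ^ (k - 2)))) := by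
        rw [hLi', hQk] at heq; linarith
      exact mul_left_cancel₀ (by linarith) this
    refine ⟨i + k - 1, ?_⟩
    have e : U (i + k - 1 + 1) = U i := by
      rw [show i + k - 1 + 1 = i + k by omega, hper]
    rcases hstep (i + k - 1) with h | h
    · rw [e, hUi] at h
      exact (mul_left_cancel₀ (by linarith) h).symm
    · have := hinc (i + k - 1)
      rw [← h, e, hUi] at this
      exact absurd (hmin (i + k - 1)) (not_le.mpr this)
  · exfalso
    rw [show i + 1 + a = i + k by omega, hper] at hru
    have hk' : Q ^ k = Q ^ a * Q := by rw [← hc]; ring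
    rw [hLi'] at hru
    have h1 : (Q ^ k - 1) * U i = - (Q ^ a * (p * (1 + Q ^ k))) := by rw [hk'] at hru ⊢; linarith
    have hdv : (Q ^ k - 1) ∣ Q ^ a * (2 * p) :=
      ⟨-U i - Q ^ a * p, by linear_combination h1⟩
    have hcop : IsCoprime (Q ^ k - 1) (Q ^ a) := ⟨-1, Q, by rw [hk']; ring⟩
    have hdv2 := hcop.dvd_of_dvd_mul_left hdv
    have := Int.le_of_dvd (by linarith) hdv2
    have h3 : Q ^ 3 ≤ Q ^ k := pow_le_pow_right₀ (by linarith) hk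
    linarith

lemma nrm_neg_dvd {n x y : ℤ} (hn : 0 < n) (h : n ∣ y + x ∨ n ∣ y - x) : nrm n y = nrm n x := by
  apply nrm_eq hn (nrm_nonneg hn x) (two_nrm_le x)
  rcases h with ⟨c, hc⟩ | ⟨c, hc⟩ <;> rcases nrm_dvd n x with ⟨d, hd⟩ | ⟨d, hd⟩
  · right; exact ⟨c - d, by linear_combination hc - hd⟩
  · left; exact ⟨c - d, by linear_combination hc - hd⟩
  · left; exact ⟨c + d, by linear_combination hc + hd⟩
  · right; exact ⟨c + d, by linear_combination hc + hd⟩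

lemma classify (q : ℤ) (hq : 3 ≤ q) (k : ℕ) (hk : 3 ≤ k) (hko : Odd k) (n t t3 : ℤ)
    (hn : n = 1 + (q ^ 2) ^ k)
    (ht3 : (q ^ 2 + 1) * t3 = q * n + (q - 1) ^ 2 * (1 + (q ^ 2) ^ (k - 2)))
    (ht : 0 < t) (htle : t ≤ t3) (hmax : ∀ j : ℕ, nrm n (q ^ j * t) ≤ t) :
    (q ^ 2 + 1) * t = q * n ∨ t = t3 := by
  have hX' : (q ^ 2) ^ k = (q ^ 2) ^ (k - 2) * q ^ 4 := by
    rw [show q ^ 4 = (q ^ 2) ^ 2 by ring, ← pow_add]; congr 1; omega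
  have hXq : q ^ 2 ≤ (q ^ 2) ^ (k - 2) := le_self_pow₀ (by nlinarith) (by omega)
  set X := (q ^ 2) ^ (k - 2) with hXdef
  have hq2 : 9 ≤ q ^ 2 := by nlinarith
  have hnX : n = 1 + X * q ^ 4 := by rw [hn, hX']
  have hXpos : 0 < X := by linarith
  have hn0 : 0 < n := by rw [hnX]; positivity
  -- q * t3 < n
  have hc : q * t3 < n := by
    have : (q ^ 2 + 1) * (q * t3) < (q ^ 2 + 1) * n := by
      have h1 : (q ^ 2 + 1) * (q * t3) = q * (q * n + (q - 1) ^ 2 * (1 + X)) := by rw [← ht3]; ring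
      have h2 : q * ((q - 1) ^ 2 * (1 + X)) < n := by
        have h3 : (q - 1) ^ 2 ≤ q ^ 2 := by nlinarith
        have h4 : 1 + X ≤ 2 * X := by linarith
        have h5 : (q - 1) ^ 2 * (1 + X) ≤ q ^ 2 * (2 * X) := by gcongr
        have h6 : q * ((q - 1) ^ 2 * (1 + X)) ≤ q * (q ^ 2 * (2 * X)) := by gcongr
        have h7 : q * (q ^ 2 * (2 * X)) ≤ q * (q ^ 2 * (q * X)) := by gcongr; linarith
        rw [hnX]; linarith
      rw [h1]; linarith
    exact lt_of_mul_lt_mul_left this (by positivity)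
  have hq0 : 0 < q := by linarith
  set y : ℕ → ℤ := fun j => nrm n (q ^ j * t) with hy
  have hyt : ∀ j, y j ≤ t := hmax
  have hy0 : y 0 = t := by
    simp only [hy, pow_zero, one_mul]
    exact nrm_eq hn0 ht.le (by nlinarith) (Or.inl (by simp))
  have hystep : ∀ j, y (j + 1) = q * y j ∨ y (j + 1) = n - q * y j := by
    intro j
    have := nrm_step (x := q ^ j * t) hn0 hq0 hc ((hyt j).trans htle)
    simp only [hy]
    rw [pow_succ', mul_assoc]
    exact this
  have hyper : ∀ j, y (j + 2 * k) = y j := by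
    intro j
    simp only [hy]
    apply nrm_neg_dvd hn0
    left
    exact ⟨q ^ j * t, by rw [hn, pow_add, ← pow_mul]; ring⟩
  -- (q+1) y ≠ n
  have hne : (q + 1) * t ≠ n := by
    intro h
    have h1 : (q + 1) ∣ (q ^ 2) ^ k - 1 := by
      have : (q ^ 2 - 1) ∣ (q ^ 2) ^ k - 1 ^ k := sub_dvd_pow_sub_pow _ _ _
      rw [one_pow] at this
      exact Dvd.dvd.trans ⟨q - 1, by ring⟩ this
    have h2 : (q + 1) ∣ 2 := by
      have := dvd_sub (Dvd.intro _ h) h1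
      rwa [hn, show 1 + (q ^ 2) ^ k - ((q ^ 2) ^ k - 1) = 2 by ring] at this
    have := Int.le_of_dvd (by norm_num) h2
    linarith
  have hbig0 : n < (q + 1) * t := by
    rcases lt_or_gt_of_ne hne with h | h
    · exfalso
      have h1 := hyt 1
      rcases hystep 0 with h2 | h2 <;> rw [zero_add, hy0] at h2
      · nlinarith
      · linarith
    · exact h
  have hUc0 : 0 < (q - 1) ^ 2 * (1 + X) := by
    have : 0 < q - 1 := by linarith
    positivity
  -- n-q t3 large
  have hlow : n < (q + 1) * (q * (n - q * t3)) := by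
    have : (q ^ 2 + 1) * n < (q ^ 2 + 1) * ((q + 1) * (q * (n - q * t3))) := by
      have h1 : (q ^ 2 + 1) * ((q + 1) * (q * (n - q * t3))) =
        (q + 1) * q * (n - q * ((q - 1) ^ 2 * (1 + X))) := by
        linear_combination (-(q+1) * q * q) * ht3
      rw [h1]
      have h2 : (q ^ 2 * (q ^ 2 - 1)) * (1 + X) < n := by
        rw [hnX]; nlinarith
      nlinarith
    exact lt_of_mul_lt_mul_left this (by positivity)
  have hbigstep : ∀ j, n < (q + 1) * y j → y (j + 1) = n - q * y j := by
    intro j h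
    rcases hystep j with h1 | h1
    · exfalso
      have h2 : q * y j ≤ t3 := by rw [← h1]; exact (hyt _).trans htle
      have h3 : q * (q * y j) < n := by nlinarith
      nlinarith
    · exact h1
  have hbig2 : ∀ j, n < (q + 1) * y j → n < (q + 1) * y (j + 2) := by
    intro j h
    have h1 := hbigstep j h
    have h4 := (hyt j).trans htle
    rcases hystep (j + 1) with h2 | h2
    · rw [h2, h1]
      have : q * (n - q * t3) ≤ q * (n - q * y j) := by gcongr
      nlinarith
    · rw [h2, h1]
      nlinarith
  have hbig : ∀ j, n < (q + 1) * y (2 * j) := by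
    intro j
    induction j with
    | zero => simpa [hy0] using hbig0
    | succ j ih => exact hbig2 _ ih
  have hcore := U_core (q ^ 2) ((q - 1) ^ 2) hq2 (by have : 0 < q - 1 := by linarith
                                                     positivity)
    (by nlinarith [mul_le_mul_of_nonneg_left hq2 (sq_nonneg (q ^ 2)), mul_le_mul_of_nonneg_left hq2 (sq_nonneg q)]) k hk hko
    (fun j => (q ^ 2 + 1) * y (2 * j) - q * n)
    (by
      intro j
      have h1 := hbigstep _ (hbig j)
      show (q ^ 2 + 1) * y (2 * j + 1 + 1) - q * n = _ ∨ (q ^ 2 + 1) * y (2 * j + 1 + 1) - q * n = _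
      rw [← hn]
      rcases hystep (2 * j + 1) with h2 | h2 <;> rw [h2, h1]
      · left; ring
      · right; ring)
    (by
      intro j
      have h4 := (hyt (2 * j)).trans htle
      show (q ^ 2 + 1) * y (2 * j) - q * n ≤ _
      have : (q ^ 2 + 1) * y (2 * j) ≤ (q ^ 2 + 1) * t3 := by gcongr
      linarith)
    (by
      intro j
      show (q ^ 2 + 1) * y (2 * (j + k)) - q * n = _
      rw [mul_add, hyper])
    (by
      intro j
      show (q ^ 2 + 1) * y (2 * j) - q * n < q ^ 2 * ((q ^ 2 + 1) * y (2 * j) - q * n) + (q - 1) ^ 2 * (1 + (q ^ 2) ^ k)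
      rw [← hn]
      have h1 := hbig j
      have h2 : 0 < (q - 1) * (q ^ 2 + 1) * ((q + 1) * y (2 * j) - n) := by
        have : 0 < q - 1 := by linarith
        have : 0 < (q + 1) * y (2 * j) - n := by linarith
        positivity
      linarith)
  rcases hcore with h | ⟨i, h⟩
  · left
    simp only [mul_zero, hy0] at h
    linarith
  · right
    have h1 : (q ^ 2 + 1) * y (2 * i) = (q ^ 2 + 1) * t3 := by rw [ht3]; linarith
    have h2 : y (2 * i) = t3 := mul_left_cancel₀ (by positivity) h1
    exact le_antisymm htle (h2 ▸ hyt _)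

/-- data of a good orbit -/
def Good (q n : ℤ) (p : ℕ) (t : ℤ) : Prop :=
  0 < t ∧ 2 * t < n ∧ n ∣ q ^ p * t + t ∧ ∀ j : ℕ, 0 < j → j < p → nrm n (q ^ j * t) < t

lemma good_t2 (q : ℤ) (hq : 3 ≤ q) (n t2 : ℤ) (hn : 0 < n) (h : (q ^ 2 + 1) * t2 = q * n)
    (hd : (q ^ 2 + 1) ∣ n) : Good q n 2 t2 := by
  obtain ⟨r, rfl⟩ := hd
  have hr : 0 < r := by
    by_contra hh; nlinarith
  have e : t2 = q * r := by
    apply mul_left_cancel₀ (show (q ^ 2 + 1) ≠ 0 by positivity); rw [h]; ring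
  subst e
  refine ⟨by positivity, by nlinarith, ⟨q, by ring⟩, ?_⟩
  intro j h0 h1
  have : j = 1 := by omega
  subst this
  have hq2 : 9 ≤ q ^ 2 := by nlinarith
  rw [nrm_eq (z := r) hn hr.le (by nlinarith [mul_le_mul_of_nonneg_right hq2 hr.le]) (Or.inr ⟨1, by ring⟩)]
  nlinarith

set_option maxHeartbeats 1000000 in
lemma good_t3 (q : ℤ) (hq : 3 ≤ q) (k : ℕ) (hk : 3 ≤ k) (hko : Odd k) (n t3 : ℤ)
    (hn : n = 1 + (q ^ 2) ^ k)
    (ht3 : (q ^ 2 + 1) * t3 = q * n + (q - 1) ^ 2 * (1 + (q ^ 2) ^ (k - 2))) :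
    Good q n (2 * k) t3 := by
  have hX' : (q ^ 2) ^ k = (q ^ 2) ^ (k - 2) * q ^ 4 := by
    rw [show q ^ 4 = (q ^ 2) ^ 2 by ring, ← pow_add]; congr 1; omega
  have hXq : q ^ 2 ≤ (q ^ 2) ^ (k - 2) := le_self_pow₀ (by nlinarith) (by omega)
  set X := (q ^ 2) ^ (k - 2) with hXdef
  have hq2 : 9 ≤ q ^ 2 := by nlinarith
  have hnX : n = 1 + X * q ^ 4 := by rw [hn, hX']
  have hXpos : 0 < X := by linarith
  have hn0 : 0 < n := by rw [hnX]; positivity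
  have hq0 : 0 < q := by linarith
  have hq1 : 0 < q - 1 := by linarith
  have hQ : 0 < q ^ 2 + 1 := by positivity
  have hUc0 : 0 < (q - 1) ^ 2 * (1 + X) := by positivity
  set Uc := (q - 1) ^ 2 * (1 + X) with hUc
  have hXq3 : q ^ 2 * X * q ≤ X * q ^ 4 := by
    have : 0 < q ^ 3 * X := by positivity
    nlinarith
  -- key numeric inequality
  have hnum : q ^ 3 * Uc < (q - 1) * n := by
    have : q ^ 3 * (q - 1) * (1 + X) < n := by
      rw [hnX]
      have : q ^ 3 * q ^ 2 ≤ q ^ 3 * X := by gcongr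
      have : q ^ 4 * 1 ≤ q ^ 4 * q := by gcongr; linarith
      nlinarith [pow_pos hq0 3]
    rw [hUc]
    nlinarith
  have hnum1 : q * Uc < (q - 1) * n := by
    have : q * Uc * 1 ≤ q * Uc * q ^ 2 := by gcongr; linarith
    linarith
  have hUn : 2 * Uc < (q - 1) ^ 2 * n := by
    have : 2 * (1 + X) < n := by rw [hnX]; nlinarith
    rw [hUc]; nlinarith [pow_pos hq1 2]
  have h2t3 : 2 * t3 < n := by
    have : (q ^ 2 + 1) * (2 * t3) < (q ^ 2 + 1) * n := by linarith
    exact lt_of_mul_lt_mul_left this hQ.le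
  have ht30 : 0 < t3 := by
    have : (q ^ 2 + 1) * 0 < (q ^ 2 + 1) * t3 := by rw [ht3]; nlinarith
    exact lt_of_mul_lt_mul_left this hQ.le
  -- evolution
  have key : ∀ i : ℕ, i < k → ∃ Z U : ℤ, (n ∣ q ^ (2 * i) * t3 - Z ∨ n ∣ q ^ (2 * i) * t3 + Z) ∧
      (q ^ 2 + 1) * Z = q * n + U ∧
      (i = 0 → U = Uc) ∧ (i = 1 → U = -q ^ 2 * Uc) ∧
      (2 ≤ i → U = (q - 1) ^ 2 * (1 - q ^ 4) * (-q ^ 2) ^ (i - 2)) := by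
    intro i
    induction i with
    | zero => intro _; exact ⟨t3, Uc, Or.inl (by simp), ht3, by simp, by simp, by simp⟩
    | succ i ih =>
      intro hi
      obtain ⟨Z, U, h1, h2, h3, h4, h5⟩ := ih (by omega)
      have hpw : q ^ (2 * (i + 1)) = q ^ 2 * q ^ (2 * i) := by rw [← pow_add]; congr 1; ring
      by_cases hi1 : i = 1
      · subst hi1
        refine ⟨n - q * (n - q * Z), q ^ 2 * U + (q - 1) ^ 2 * n, ?_, ?_, by simp, by simp, ?_⟩
        · rw [hpw]
          rcases h1 with ⟨c, hc⟩ | ⟨c, hc⟩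
          · left; exact ⟨q ^ 2 * c - 1 + q, by linear_combination q ^ 2 * hc⟩
          · right; exact ⟨q ^ 2 * c + 1 - q, by linear_combination q ^ 2 * hc⟩
        · linear_combination q ^ 2 * h2
        · intro _
          rw [h4 rfl, hUc, hnX]; simp; ring
      · refine ⟨q * (n - q * Z), -q ^ 2 * U, ?_, ?_, by simp, ?_, ?_⟩
        · rw [hpw]
          rcases h1 with ⟨c, hc⟩ | ⟨c, hc⟩
          · right; exact ⟨q ^ 2 * c + q, by linear_combination q ^ 2 * hc⟩
          · left; exact ⟨q ^ 2 * c - q, by linear_combination q ^ 2 * hc⟩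
        · linear_combination (-q ^ 2) * h2
        · intro h; rw [h3 (by omega)]
        · intro h
          rw [h5 (by omega), show i + 1 - 2 = (i - 2) + 1 by omega, pow_succ]; ring
  have key2 : ∀ i : ℕ, i < k → ∃ Z U : ℤ, (n ∣ q ^ (2 * i) * t3 - Z ∨ n ∣ q ^ (2 * i) * t3 + Z) ∧
      (q ^ 2 + 1) * Z = q * n + U ∧ -q ^ 2 * Uc ≤ U ∧ U ≤ Uc ∧ (0 < i → U < Uc) := by
    intro i hi
    obtain ⟨Z, U, h1, h2, h3, h4, h5⟩ := key i hi
    refine ⟨Z, U, h1, h2, ?_⟩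
    have hneg : -q ^ 2 * Uc < 0 := by
      have : 0 < q ^ 2 * Uc := by positivity
      linarith
    rcases Nat.lt_or_ge i 2 with hlt | hge
    · have : i = 0 ∨ i = 1 := by omega
      rcases this with h | h
      · rw [h3 h]; exact ⟨by linarith, le_refl _, by omega⟩
      · rw [h4 h]; exact ⟨le_refl _, by linarith, fun _ => by linarith⟩
    · have hU := h5 hge
      have hp2 : 0 < (q - 1) ^ 2 := by positivity
      have hq4 : 0 < q ^ 4 - 1 := by nlinarith
      rcases Nat.even_or_odd (i - 2) with he | ho
      · rw [he.neg_pow] at hU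
        have hle : (q ^ 2) ^ (i - 2) * q ^ 2 ≤ X := by
          rw [← pow_succ]
          exact pow_le_pow_right₀ (by linarith) (by omega)
        have hpos : 0 < (q ^ 2) ^ (i - 2) := by positivity
        have hUneg : U < 0 := by
          have : 0 < (q - 1) ^ 2 * (q ^ 4 - 1) * (q ^ 2) ^ (i - 2) := by positivity
          rw [hU]; linarith
        refine ⟨?_, by linarith, fun _ => by linarith⟩
        have : (q ^ 4 - 1) * (q ^ 2) ^ (i - 2) ≤ q ^ 2 * (1 + X) := by nlinarith
        rw [hU, hUc]; nlinarith
      · have hne : i - 2 ≠ k - 3 := by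
          intro h
          rw [h] at ho
          obtain ⟨a, ha⟩ := ho
          obtain ⟨b, hb⟩ := hko
          omega
        have hle : (q ^ 2) ^ (i - 2) * q ^ 4 ≤ X := by
          rw [show q ^ 4 = (q ^ 2) ^ 2 by ring, ← pow_add]
          exact pow_le_pow_right₀ (by linarith) (by omega)
        rw [ho.neg_pow] at hU
        have hpos : 0 < (q ^ 2) ^ (i - 2) := by positivity
        have hUpos : 0 < U := by
          have : 0 < (q - 1) ^ 2 * (q ^ 4 - 1) * (q ^ 2) ^ (i - 2) := by positivity
          rw [hU]; linarith
        have hUlt : U < Uc := by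
          have : (q ^ 4 - 1) * (q ^ 2) ^ (i - 2) < 1 + X := by nlinarith
          rw [hU, hUc]; nlinarith
        exact ⟨by linarith, hUlt.le, fun _ => hUlt⟩
  refine ⟨ht30, h2t3, ⟨t3, by rw [hn, pow_mul]; ring⟩, ?_⟩
  intro j hj0 hj
  obtain ⟨Z, U, h1, h2, h3, h4, h5⟩ := key2 (j / 2) (by omega)
  have hZ0 : 0 ≤ Z := by
    have : (q ^ 2 + 1) * 0 ≤ (q ^ 2 + 1) * Z := by
      rw [h2]
      have : q * (q ^ 2 * Uc) ≤ q * (q * n) := by nlinarith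
      have : q ^ 2 * Uc ≤ q * n := le_of_mul_le_mul_left this hq0
      linarith
    exact le_of_mul_le_mul_left this hQ
  have hZle : Z ≤ t3 := by
    have : (q ^ 2 + 1) * Z ≤ (q ^ 2 + 1) * t3 := by linarith
    exact le_of_mul_le_mul_left this hQ
  rcases Nat.mod_two_eq_zero_or_one j with hm | hm
  · have hj2 : j = 2 * (j / 2) := by omega
    rw [hj2, nrm_eq hn0 hZ0 (by linarith) h1]
    have := h5 (by omega)
    have : (q ^ 2 + 1) * Z < (q ^ 2 + 1) * t3 := by linarith
    exact lt_of_mul_lt_mul_left this hQ.le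
  · have hj2 : j = 2 * (j / 2) + 1 := by omega
    have hlt : n - q * Z < t3 := by
      have : (q ^ 2 + 1) * (n - q * Z) < (q ^ 2 + 1) * t3 := by
        have : q * (-q ^ 2 * Uc) ≤ q * U := by gcongr
        rw [ht3]
        have e : (q ^ 2 + 1) * (n - q * Z) = n - q * U := by linear_combination (-q) * h2
        rw [e]; linarith
      exact lt_of_mul_lt_mul_left this hQ.le
    have hge : 0 ≤ n - q * Z := by
      have : (q ^ 2 + 1) * 0 ≤ (q ^ 2 + 1) * (n - q * Z) := by
        have e : (q ^ 2 + 1) * (n - q * Z) = n - q * U := by linear_combination (-q) * h2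
        rw [e]
        have : q * U ≤ q * Uc := by gcongr
        have : q ^ 2 * (q * Uc) < q ^ 2 * n := by nlinarith
        have := lt_of_mul_lt_mul_left this (by positivity)
        linarith
      exact le_of_mul_le_mul_left this hQ
    rw [hj2, nrm_eq (z := n - q * Z) hn0 hge (by linarith)]
    · exact hlt
    · rw [pow_succ]
      rcases h1 with ⟨c, hc⟩ | ⟨c, hc⟩
      · right; exact ⟨q * c + 1, by linear_combination q * hc⟩
      · left; exact ⟨q * c - 1, by linear_combination q * hc⟩

lemma exists_data (q : ℤ) (hq : 3 ≤ q) (m : ℕ) (hm4 : m % 4 = 2) (n : ℤ) (hn : n = q ^ m + 1) :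
    ∃ t2 t3 : ℤ, t2 < t3 ∧ Good q n 2 t2 ∧ Good q n m t3 ∧
      ∀ t, 0 < t → t ≤ t3 → (∀ j : ℕ, nrm n (q ^ j * t) ≤ t) → t = t2 ∨ t = t3 := by
  have hq2 : 9 ≤ q ^ 2 := by nlinarith
  have hQ : 0 < q ^ 2 + 1 := by positivity
  by_cases hm2 : m = 2
  · subst hm2
    have hn0 : 0 < n := by rw [hn]; positivity
    refine ⟨q, q + 1, by linarith, ?_, ?_, ?_⟩
    · refine ⟨by linarith, by nlinarith, ⟨q, by rw [hn]; ring⟩, ?_⟩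
      intro j h0 h1
      have : j = 1 := by omega
      subst this
      rw [nrm_eq (z := 1) hn0 (by norm_num) (by linarith) (Or.inr ⟨1, by rw [hn]; ring⟩)]
      linarith
    · refine ⟨by linarith, by nlinarith, ⟨q + 1, by rw [hn]; ring⟩, ?_⟩
      intro j h0 h1
      have : j = 1 := by omega
      subst this
      rw [nrm_eq (z := q - 1) hn0 (by linarith) (by nlinarith) (Or.inl ⟨1, by rw [hn]; ring⟩)]
      linarith
    · intro t ht htle hmax
      by_contra hcon
      push Not at hcon
      have ht1 : t ≤ q - 1 := by
        have := hcon.1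
        have := hcon.2
        omega
      have h0 : nrm n t = t := nrm_eq hn0 ht.le (by nlinarith) (Or.inl (by simp))
      have h1 := hmax 1
      rw [pow_one] at h1
      rcases nrm_step (q := q) (x := t) (c := q - 1) hn0 (by linarith) (by nlinarith) (by linarith) with h | h <;>
        rw [h, h0] at h1 <;> nlinarith
  · obtain ⟨k, rfl⟩ : ∃ k, m = 2 * k := ⟨m / 2, by omega⟩
    have hk : 3 ≤ k := by omega
    have hko : Odd k := Nat.odd_iff.mpr (by omega)
    have hko2 : Odd (k - 2) := Nat.odd_iff.mpr (by omega)
    have hn' : n = 1 + (q ^ 2) ^ k := by rw [hn, pow_mul]; ring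
    have hn0 : 0 < n := by rw [hn']; positivity
    have hd : ∀ a : ℕ, Odd a → (q ^ 2 + 1) ∣ 1 + (q ^ 2) ^ a := by
      intro a ha
      have := ha.add_dvd_pow_add_pow (q ^ 2) 1
      rwa [one_pow, add_comm ((q ^ 2) ^ a)] at this
    obtain ⟨r, hr⟩ := hd k hko
    obtain ⟨r', hr'⟩ := hd (k - 2) hko2
    have hr0 : 0 < r' := by
      by_contra hh
      have : 0 < 1 + (q ^ 2) ^ (k - 2) := by positivity
      nlinarith
    have ht3 : (q ^ 2 + 1) * (q * r + (q - 1) ^ 2 * r') =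
        q * n + (q - 1) ^ 2 * (1 + (q ^ 2) ^ (k - 2)) := by rw [hn', hr, hr']; ring
    have ht2 : (q ^ 2 + 1) * (q * r) = q * n := by rw [hn', hr]; ring
    refine ⟨q * r, q * r + (q - 1) ^ 2 * r', ?_, ?_, ?_, ?_⟩
    · have : 0 < q - 1 := by linarith
      have : 0 < (q - 1) ^ 2 * r' := by positivity
      linarith
    · exact good_t2 q hq n _ hn0 ht2 (by rw [hn']; exact hd k hko)
    · exact good_t3 q hq k hk hko n _ hn' ht3
    · intro t ht htle hmax
      rcases classify q hq k hk hko n t _ hn' ht3 ht htle hmax with h | h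
      · left
        exact mul_left_cancel₀ hQ.ne' (h.trans ht2.symm)
      · right; exact h

lemma mem_coset {q n N s x : ℕ} (hn : 0 < n) (hN : 0 < N) (hord : ((q : ZMod n)) ^ N = 1) :
    x ∈ cycCoset q n s ↔ x < n ∧ ∃ j : ℕ, (x : ZMod n) = s * q ^ j := by
  unfold cycCoset
  simp only [Finset.mem_image, Finset.mem_range]
  constructor
  · rintro ⟨j, -, rfl⟩
    exact ⟨Nat.mod_lt _ hn, j, by simp⟩
  · rintro ⟨hx, j, hj⟩
    have hpos : 0 < orderOf (q : ZMod n) := orderOf_pos_iff.mpr (isOfFinOrder_iff_pow_eq_one.mpr ⟨N, hN, hord⟩)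
    refine ⟨j % orderOf (q : ZMod n), Nat.mod_lt _ hpos, ?_⟩
    have : ((s * q ^ (j % orderOf (q : ZMod n)) : ℕ) : ZMod n) = (x : ℕ) := by
      push_cast
      rw [pow_mod_orderOf, hj]
    have := (ZMod.natCast_eq_natCast_iff' _ _ _).mp this
    rw [this, Nat.mod_eq_of_lt hx]

lemma coset_trans {q n N s x : ℕ} (hn : 0 < n) (hN : 0 < N) (hord : ((q : ZMod n)) ^ N = 1)
    (h : x ∈ cycCoset q n s) : cycCoset q n x = cycCoset q n s := by
  obtain ⟨hx, j, hj⟩ := (mem_coset hn hN hord).mp h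
  ext z
  rw [mem_coset hn hN hord, mem_coset hn hN hord]
  refine and_congr_right fun _ => ⟨?_, ?_⟩
  · rintro ⟨i, hi⟩
    exact ⟨j + i, by rw [hi, hj, pow_add, mul_assoc]⟩
  · rintro ⟨i, hi⟩
    refine ⟨i + j * (N - 1), ?_⟩
    rw [hi, hj, mul_assoc, ← pow_add]
    congr 1
    have : j + (i + j * (N - 1)) = i + N * j := by
      obtain ⟨M, rfl⟩ := Nat.exists_eq_add_of_lt hN
      simp; ring
    rw [this, pow_add, pow_mul, hord, one_pow, mul_one]

lemma self_mem_coset {q n N s : ℕ} (hn : 0 < n) (hN : 0 < N) (hord : ((q : ZMod n)) ^ N = 1)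
    (h : s < n) : s ∈ cycCoset q n s :=
  (mem_coset hn hN hord).mpr ⟨h, 0, by simp⟩

lemma coset_zero {q n N : ℕ} (hn : 0 < n) (hN : 0 < N) (hord : ((q : ZMod n)) ^ N = 1) :
    cycCoset q n 0 = {0} := by
  ext x
  rw [mem_coset hn hN hord]
  simp only [Nat.cast_zero, zero_mul, exists_const, Finset.mem_singleton]
  constructor
  · rintro ⟨h, h0⟩
    rw [ZMod.natCast_eq_zero_iff] at h0
    exact Nat.eq_zero_of_dvd_of_lt h0 h
  · rintro rfl; exact ⟨hn, by simp⟩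

lemma mem_leaders {q n s : ℕ} : s ∈ cosetLeaders q n ↔
    s < n ∧ s ∈ cycCoset q n s ∧ ∀ x ∈ cycCoset q n s, s ≤ x := by
  simp [cosetLeaders]

lemma exists_leader {q n N x : ℕ} (hn : 0 < n) (hN : 0 < N) (hord : ((q : ZMod n)) ^ N = 1)
    (hx : x < n) : ∃ l ∈ cosetLeaders q n, x ∈ cycCoset q n l := by
  obtain ⟨l, hl, hmin⟩ := Finset.exists_min_image (cycCoset q n x) id
    ⟨x, self_mem_coset hn hN hord hx⟩
  have e := coset_trans hn hN hord hl
  refine ⟨l, mem_leaders.mpr ⟨((mem_coset hn hN hord).mp hl).1, ?_, ?_⟩, ?_⟩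
  · rw [e]; exact hl
  · rw [e]; exact hmin
  · rw [e]; exact self_mem_coset hn hN hord hx

lemma leader_unique {q n N x l l' : ℕ} (hn : 0 < n) (hN : 0 < N) (hord : ((q : ZMod n)) ^ N = 1)
    (hl : l ∈ cosetLeaders q n) (hl' : l' ∈ cosetLeaders q n)
    (h : x ∈ cycCoset q n l) (h' : x ∈ cycCoset q n l') : l = l' := by
  have e : cycCoset q n l = cycCoset q n l' := by
    rw [← coset_trans hn hN hord h, ← coset_trans hn hN hord h']
  rw [mem_leaders] at hl hl'
  apply le_antisymm
  · exact hl.2.2 _ (e ▸ hl'.2.1)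
  · exact hl'.2.2 _ (e ▸ hl.2.1)

lemma union_card {q n N δ : ℕ} (hn : 0 < n) (hN : 0 < N) (hord : ((q : ZMod n)) ^ N = 1)
    (hδ : δ ≤ n) (K : Finset ℕ) (hK : K ⊆ cosetLeaders q n) (hK0 : 0 ∉ K)
    (h : ∀ l ∈ cosetLeaders q n, l ≠ 0 → (δ ≤ l ↔ l ∈ K)) :
    ((Finset.Icc 1 (δ - 1)).biUnion (cycCoset q n)).card =
      n - (∑ l ∈ K, (cycCoset q n l).card + 1) := by
  have h0 : (0 : ℕ) ∈ cosetLeaders q n := by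
    rw [mem_leaders, coset_zero hn hN hord]; simp [hn]
  have hK' : insert 0 K ⊆ cosetLeaders q n := by
    intro l hl
    rcases Finset.mem_insert.mp hl with rfl | hl
    · exact h0
    · exact hK hl
  have hset : (Finset.Icc 1 (δ - 1)).biUnion (cycCoset q n) =
      Finset.range n \ (insert 0 K).biUnion (cycCoset q n) := by
    ext x
    simp only [Finset.mem_biUnion, Finset.mem_sdiff, Finset.mem_range, Finset.mem_Icc]
    constructor
    · rintro ⟨i, ⟨hi1, hi2⟩, hx⟩
      refine ⟨((mem_coset hn hN hord).mp hx).1, ?_⟩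
      rintro ⟨l, hl, hxl⟩
      have e : cycCoset q n l = cycCoset q n i := by
        rw [← coset_trans hn hN hord hx, ← coset_trans hn hN hord hxl]
      have hii : i ∈ cycCoset q n l := e ▸ self_mem_coset hn hN hord (by omega)
      have hll := mem_leaders.mp (hK' hl)
      have hle := hll.2.2 _ hii
      rcases Finset.mem_insert.mp hl with rfl | hl'
      · rw [coset_zero hn hN hord] at hii
        simp at hii; omega
      · have := (h l (hK hl') (fun h => hK0 (h ▸ hl'))).mpr hl'
        omega
    · rintro ⟨hx, hnot⟩
      obtain ⟨l, hl, hxl⟩ := exists_leader hn hN hord hx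
      have hl0 : l ≠ 0 := fun e => hnot ⟨l, by simp [e], hxl⟩
      have hlK : ¬ δ ≤ l := fun e => hnot ⟨l, Finset.mem_insert_of_mem ((h l hl hl0).mp e), hxl⟩
      exact ⟨l, ⟨by omega, by omega⟩, hxl⟩
  rw [hset, Finset.card_sdiff_of_subset, Finset.card_range, Finset.card_biUnion,
    Finset.sum_insert hK0, coset_zero hn hN hord, Finset.card_singleton, add_comm]
  · intro l hl l' hl' hne
    show Disjoint (cycCoset q n l) (cycCoset q n l')
    rw [Finset.disjoint_left]
    intro x hx hx'
    exact hne (leader_unique hn hN hord (hK' hl) (hK' hl') hx hx')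
  · intro x hx
    obtain ⟨l, -, hxl⟩ := Finset.mem_biUnion.mp hx
    exact Finset.mem_range.mpr ((mem_coset hn hN hord).mp hxl).1

lemma sort_top (S : Finset ℕ) (a b c : ℕ) (ha : a ∈ S) (hb : b ∈ S) (hc : c ∈ S)
    (hcb : c < b) (hba : b < a) (hS : ∀ x ∈ S, x = a ∨ x = b ∨ x = c ∨ x < c)
    (hex : ∃ x ∈ S, x < c) :
    ((S.sort (· ≤ ·)).reverse).getD 1 0 = b ∧ ((S.sort (· ≤ ·)).reverse).getD 2 0 = c ∧
    ((S.sort (· ≤ ·)).reverse).getD 3 0 < c ∧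
    ∀ x ∈ S, x < c → x ≤ ((S.sort (· ≤ ·)).reverse).getD 3 0 := by
  set R := S.filter (· < c) with hR
  have hRm : ∀ x, x ∈ R ↔ x ∈ S ∧ x < c := by simp [hR]
  have hsort : S.sort (· ≤ ·) = R.sort (· ≤ ·) ++ [c, b, a] := by
    have hp : (R.sort (· ≤ ·) ++ [c, b, a]).Pairwise (· < ·) := by
      rw [List.pairwise_append]
      refine ⟨(Finset.sortedLT_sort R).pairwise, by simp; omega, ?_⟩
      intro x hx y hy
      have := ((hRm x).mp ((Finset.mem_sort _).mp hx)).2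
      simp at hy; omega
    apply List.Perm.eq_of_pairwise' (r := (· ≤ ·)) (Finset.pairwise_sort _ _) (hp.imp le_of_lt)
    rw [List.perm_ext_iff_of_nodup (Finset.sort_nodup _ _) (hp.imp ne_of_lt)]
    intro x
    simp only [Finset.mem_sort, List.mem_append, hRm, List.mem_cons, List.not_mem_nil, or_false]
    constructor
    · intro hx
      have := hS x hx
      tauto
    · rintro (h | rfl | rfl | rfl)
      · exact h.1
      all_goals assumption
  rw [hsort]
  obtain ⟨z, hz, hzc⟩ := hex
  have hzR : z ∈ (R.sort (· ≤ ·)).reverse := by simp [hRm, hz, hzc]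
  have hpw : ((R.sort (· ≤ ·)).reverse).Pairwise (fun x y => y ≤ x) := by
    rw [List.pairwise_reverse]; exact Finset.pairwise_sort _ _
  have hmem : ∀ x, x ∈ (R.sort (· ≤ ·)).reverse ↔ x ∈ S ∧ x < c := by simp [hRm]
  rw [List.reverse_append]
  generalize (R.sort (· ≤ ·)).reverse = l at *
  cases l with
  | nil => simp at hzR
  | cons d l =>
    simp
    refine ⟨((hmem d).mp (by simp)).2, ?_⟩
    intro x hx hxc
    have := (hmem x).mpr ⟨hx, hxc⟩
    rcases List.mem_cons.mp this with rfl | h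
    · exact le_rfl
    · exact (List.pairwise_cons.mp hpw).1 x h

lemma dvd_congr_int {n a b : ℤ} (h : n ∣ a) (e : b = a) : n ∣ b := e ▸ h

lemma shift_dvd {q h n s : ℕ} {t : ℤ} (hodd : Odd q) (hn : n = 2 * h) (hs : (s : ℤ) = h - t) (j : ℕ) :
    (n : ℤ) ∣ (s : ℤ) * q ^ j - (h - q ^ j * t) := by
  have h1 : Odd ((q : ℤ) ^ j) := by
    have : Odd (q : ℤ) := by exact_mod_cast hodd
    exact this.pow
  obtain ⟨c, hc⟩ := h1
  refine ⟨c, ?_⟩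
  rw [hs, hn]; push_cast
  linear_combination (h : ℤ) * hc

lemma mem_coset_int {q n N s x : ℕ} (hn : 0 < n) (hN : 0 < N) (hord : ((q : ZMod n)) ^ N = 1) :
    x ∈ cycCoset q n s ↔ x < n ∧ ∃ j : ℕ, (n : ℤ) ∣ (s : ℤ) * q ^ j - x := by
  rw [mem_coset hn hN hord]
  refine and_congr_right fun _ => exists_congr fun j => ?_
  have := ZMod.intCast_zmod_eq_zero_iff_dvd ((s : ℤ) * q ^ j - x) n
  rw [← this]
  push_cast
  rw [sub_eq_zero, eq_comm]

lemma leader_max {q m n h s N : ℕ} (hodd : Odd q) (hn : n = q ^ m + 1) (hh : n = 2 * h)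
    (hN : 0 < N) (hord : ((q : ZMod n)) ^ N = 1)
    (hs : s ∈ cosetLeaders q n) :
    s ≤ h ∧ ∀ j : ℕ, nrm n ((q : ℤ) ^ j * (h - s)) ≤ h - s := by
  have hn0 : 0 < n := by omega
  have hnz : (0 : ℤ) < n := by exact_mod_cast hn0
  rw [mem_leaders] at hs
  have key : ∀ j : ℕ, nrm n ((q : ℤ) ^ j * (h - s)) ≤ h - s := by
    intro j
    set z := nrm n ((q : ℤ) ^ j * (h - s)) with hz
    have z0 : 0 ≤ z := nrm_nonneg hnz _
    have z1 : 2 * z ≤ n := two_nrm_le _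
    obtain ⟨x, hx⟩ : ∃ x : ℕ, (x : ℤ) = h - z := ⟨(h - z).toNat, by omega⟩
    have hxm : x ∈ cycCoset q n s := by
      rw [mem_coset_int hn0 hN hord]
      refine ⟨by omega, ?_⟩
      rcases nrm_dvd n ((q : ℤ) ^ j * (h - s)) with h1 | h1
      · refine ⟨j, ?_⟩
        have h2 := shift_dvd (s := s) (t := h - s) hodd hh (by ring) j
        have h3 := dvd_sub h2 h1
        rw [hx]
        refine dvd_congr_int h3 ?_
        ring
      · refine ⟨j + m, ?_⟩
        have h2 := shift_dvd (s := s) (t := h - s) hodd hh (by ring) (j + m)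
        have h4 : (n : ℤ) ∣ n * ((q : ℤ) ^ j * (h - s)) := Dvd.intro _ rfl
        have h3 := dvd_add (dvd_sub h2 h4) h1
        rw [hx]
        refine dvd_congr_int h3 ?_
        rw [← hz]
        have hnc : (n : ℤ) = (q : ℤ) ^ m + 1 := by rw [hn]; push_cast; ring
        rw [pow_add]
        linear_combination ((q : ℤ) ^ j * (h - s)) * hnc
    have := hs.2.2 x hxm
    omega
  refine ⟨?_, key⟩
  have := key 0
  have h0 := nrm_nonneg hnz ((q : ℤ) ^ 0 * (h - s))
  omega

lemma good_mod {q n : ℤ} {p : ℕ} {t : ℤ} (hn : 0 < n) (hG : Good q n p t) (j : ℕ) :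
    nrm n (q ^ (j + p) * t) = nrm n (q ^ j * t) := by
  apply nrm_neg_dvd hn
  left
  have h := hG.2.2.1
  have h2 := Dvd.dvd.mul_left h (q ^ j)
  refine dvd_congr_int h2 ?_
  rw [pow_add]; ring

lemma good_le {q n : ℤ} {p : ℕ} {t : ℤ} (hp : 0 < p) (hn : 0 < n) (hG : Good q n p t) (j : ℕ) :
    nrm n (q ^ j * t) ≤ t := by
  induction j using Nat.strong_induction_on with
  | _ j ih =>
    rcases lt_or_ge j p with h | h
    · rcases Nat.eq_zero_or_pos j with rfl | h0
      · rw [nrm_eq (z := t) hn hG.1.le hG.2.1.le (Or.inl (by simp))]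
      · exact (hG.2.2.2 j h0 h).le
    · obtain ⟨l, rfl⟩ := Nat.exists_eq_add_of_le' h
      rw [good_mod hn hG]
      exact ih l (by omega)

lemma good_leader {q m n h s N p : ℕ} {t : ℤ} (hodd : Odd q) (hm : 0 < m) (hn : n = q ^ m + 1)
    (hh : n = 2 * h) (hN : 0 < N) (hord : ((q : ZMod n)) ^ N = 1) (hp : 0 < p)
    (hG : Good q n p t) (hs : (s : ℤ) = h - t) :
    s ∈ cosetLeaders q n ∧ (cycCoset q n s).card = 2 * p := by
  have hn0 : 0 < n := by omega
  have hnz : (0 : ℤ) < n := by exact_mod_cast hn0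
  have ht0 := hG.1
  have ht1 := hG.2.1
  have hsn : s < n := by omega
  constructor
  · rw [mem_leaders]
    refine ⟨hsn, self_mem_coset hn0 hN hord hsn, ?_⟩
    intro x hx
    obtain ⟨hxn, j, hj⟩ := (mem_coset_int hn0 hN hord).mp hx
    by_contra hlt
    have h2 := shift_dvd hodd hh hs j
    have h3 := dvd_sub hj h2
    have hz : nrm n ((q : ℤ) ^ j * t) = h - x :=
      nrm_eq hnz (by omega) (by omega) (Or.inl (by
        rw [← dvd_neg]; refine dvd_congr_int h3 ?_; ring))
    have := good_le hp hnz hG j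
    omega
  · have hcop : IsCoprime (n : ℤ) (q : ℤ) := by
      refine ⟨1, -(q : ℤ) ^ (m - 1), ?_⟩
      rw [hn]; push_cast
      have : (q : ℤ) ^ m = q ^ (m - 1) * q := by rw [← pow_succ]; congr 1; omega
      rw [this]; ring
    have himg : cycCoset q n s = (Finset.range (2 * p)).image fun j => s * q ^ j % n := by
      ext x
      rw [mem_coset_int hn0 hN hord]
      simp only [Finset.mem_image, Finset.mem_range]
      have hperiod : ∀ j : ℕ, (n : ℤ) ∣ (s : ℤ) * q ^ (j + 2 * p) - s * q ^ j := by
        intro j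
        have h1 := shift_dvd hodd hh hs j
        have h2 := shift_dvd hodd hh hs (j + 2 * p)
        have h3 := hG.2.2.1
        have h4 := Dvd.dvd.mul_left h3 ((q : ℤ) ^ j * (q ^ p - 1))
        have h5 := dvd_sub (dvd_sub h2 h1) h4
        refine dvd_congr_int h5 ?_
        rw [pow_add, two_mul, pow_add]; ring
      constructor
      · rintro ⟨hx, j, hj⟩
        induction j using Nat.strong_induction_on with
        | _ j ih =>
          rcases lt_or_ge j (2 * p) with h | h
          · refine ⟨j, h, ?_⟩
            have h1 : ((s * q ^ j : ℕ) : ℤ) ≡ (x : ℕ) [ZMOD n] := by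
              apply Int.ModEq.symm
              rw [Int.modEq_iff_dvd]; push_cast; exact hj
            have h2 := (Int.natCast_modEq_iff).mp h1
            rw [h2, Nat.mod_eq_of_lt hx]
          · obtain ⟨l, rfl⟩ := Nat.exists_eq_add_of_le' h
            apply ih l (by omega)
            have := dvd_sub hj (hperiod l)
            refine dvd_congr_int this ?_
            ring
      · rintro ⟨j, -, rfl⟩
        refine ⟨Nat.mod_lt _ hn0, j, ?_⟩
        push_cast
        exact Int.dvd_self_sub_emod
    rw [himg, Finset.card_image_of_injOn, Finset.card_range]
    have main : ∀ i d : ℕ, 0 < d → d < 2 * p → s * q ^ i % n = s * q ^ (i + d) % n → False := by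
      intro i d hd0 hd h
      have h1 : (n : ℤ) ∣ ((s * q ^ (i + d) : ℕ) : ℤ) - ((s * q ^ i : ℕ) : ℤ) :=
        (Int.modEq_iff_dvd).mp ((Int.natCast_modEq_iff).mpr h)
      push_cast at h1
      have h2 := shift_dvd hodd hh hs i
      have h3 := shift_dvd hodd hh hs (i + d)
      have h4 := dvd_sub (dvd_sub h3 h2) h1
      have h5 : (n : ℤ) ∣ (q : ℤ) ^ i * (q ^ d * t - t) := by
        refine dvd_congr_int h4 ?_
        rw [pow_add]; ring
      have h6 : (n : ℤ) ∣ (q : ℤ) ^ d * t - t := (hcop.pow_right).dvd_of_dvd_mul_left h5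
      have h7 : nrm n ((q : ℤ) ^ d * t) = t := nrm_eq hnz ht0.le ht1.le (Or.inl h6)
      rcases lt_trichotomy d p with hlt | rfl | hgt
      · have := hG.2.2.2 d hd0 hlt
        omega
      · have h8 := dvd_sub hG.2.2.1 h6
        have h9 : (n : ℤ) ∣ 2 * t := by refine dvd_congr_int h8 ?_; ring
        have := Int.le_of_dvd (by omega) h9
        omega
      · obtain ⟨l, rfl⟩ := Nat.exists_eq_add_of_lt hgt
        have h8 := good_mod hnz hG (l + 1)
        rw [show l + 1 + p = p + l + 1 by ring, h7] at h8
        have := hG.2.2.2 (l + 1) (by omega) (by omega)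
        omega
    intro i hi j hj hij
    simp only [Finset.coe_range, Set.mem_Iio] at hi hj
    rcases lt_trichotomy i j with hlt | heq | hgt
    · exact (main i (j - i) (by omega) (by omega) (by
        rw [show i + (j - i) = j by omega]; exact hij)).elim
    · exact heq
    · exact (main j (i - j) (by omega) (by omega) (by
        rw [show j + (i - j) = i by omega]; exact hij.symm)).elim

/-- for odd prime power `q`, `m ≡ 2 (mod 4)`, `m ≥ 2`, `n = q^m+1`:
if `δ_{3,n}+1 ≤ δ ≤ δ_{2,n}` then `|C_1 ∪ ⋯ ∪ C_{δ-1}| = n - 6`;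
if `δ_{4,n}+1 ≤ δ ≤ δ_{3,n}` then `|C_1 ∪ ⋯ ∪ C_{δ-1}| = n - (2m+6)`. -/
theorem stmt_7 (q m n : ℕ) (hq : IsPrimePow q) (hodd : Odd q)
    (hm4 : m % 4 = 2) (hm : 2 ≤ m) (hn : n = q ^ m + 1) (δ : ℕ) :
    (nthLargestCosetLeader q n 3 + 1 ≤ δ → δ ≤ nthLargestCosetLeader q n 2 →
      ((Finset.Icc 1 (δ - 1)).biUnion (cycCoset q n)).card = n - 6) ∧
    (nthLargestCosetLeader q n 4 + 1 ≤ δ → δ ≤ nthLargestCosetLeader q n 3 →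
      ((Finset.Icc 1 (δ - 1)).biUnion (cycCoset q n)).card = n - (2 * m + 6)) := by
  have hq1 : 1 < q := hq.one_lt
  have hq3 : 3 ≤ q := by
    obtain ⟨c, hc⟩ := hodd
    omega
  have hqm : Odd (q ^ m) := hodd.pow
  obtain ⟨c, hc⟩ := hqm
  set h := c + 1 with hh'
  have hh : n = 2 * h := by omega
  have hn0 : 0 < n := by omega
  have hnz : (0 : ℤ) < n := by exact_mod_cast hn0
  have hm0 : 0 < m := by omega
  have hord : ((q : ZMod n)) ^ (m + m) = 1 := by
    have h1 : ((q ^ m + 1 : ℕ) : ZMod n) = 0 := by rw [← hn]; simp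
    push_cast at h1
    have h2 : (q : ZMod n) ^ m = -1 := eq_neg_of_add_eq_zero_left h1
    rw [pow_add, h2]; ring
  have hN : 0 < m + m := by omega
  obtain ⟨t2, t3, h23, hG2, hG3, hcl⟩ := exists_data (q : ℤ) (by exact_mod_cast hq3) m hm4 (n : ℤ)
    (by rw [hn]; push_cast; ring)
  have p2 := hG2.1
  have p3 := hG3.2.1
  obtain ⟨a, ha⟩ : ∃ a : ℕ, (a : ℤ) = h - t2 := ⟨(h - t2).toNat, by omega⟩
  obtain ⟨b, hb⟩ : ∃ b : ℕ, (b : ℤ) = h - t3 := ⟨(h - t3).toNat, by omega⟩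
  obtain ⟨hal, hac⟩ := good_leader hodd hm0 hn hh hN hord (by norm_num) hG2 ha
  obtain ⟨hbl, hbc⟩ := good_leader hodd hm0 hn hh hN hord hm0 hG3 hb
  have hhs : cycCoset q n h = {h} := by
    ext x
    rw [mem_coset_int hn0 hN hord, Finset.mem_singleton]
    constructor
    · rintro ⟨hx, j, hj⟩
      have h1 := shift_dvd (s := h) (t := 0) hodd hh (by ring) j
      have h2 := dvd_sub h1 hj
      have h3 : (n : ℤ) ∣ x - h := by refine dvd_congr_int h2 ?_; ring
      have h4 : (x : ℤ) - h = 0 := by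
        apply Int.eq_zero_of_abs_lt_dvd h3
        rw [abs_lt]; omega
      omega
    · rintro rfl
      exact ⟨by omega, 0, by simp⟩
  have hhl : h ∈ cosetLeaders q n := by
    rw [mem_leaders, hhs]; simp; omega
  have h0l : 0 ∈ cosetLeaders q n := by
    rw [mem_leaders, coset_zero hn0 hN hord]; simp [hn0]
  have hall : ∀ x ∈ cosetLeaders q n, x = h ∨ x = a ∨ x = b ∨ x < b := by
    intro x hx
    obtain ⟨hxh, hxm⟩ := leader_max hodd hn hh hN hord hx
    by_contra hcon
    push Not at hcon
    rcases hcl (h - x) (by omega) (by omega) hxm with e | e <;> omega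
  obtain ⟨e2, e3, e4, hr⟩ := sort_top (cosetLeaders q n) h a b hhl hal hbl (by omega) (by omega) hall
    ⟨0, h0l, by omega⟩
  have d2 : nthLargestCosetLeader q n 2 = a := e2
  have d3 : nthLargestCosetLeader q n 3 = b := e3
  have d4 : nthLargestCosetLeader q n 4 < b := e4
  have d4' : ∀ x ∈ cosetLeaders q n, x < b → x ≤ nthLargestCosetLeader q n 4 := hr
  constructor
  · intro h1 h2
    rw [d3] at h1
    rw [d2] at h2
    rw [union_card hn0 hN hord (by omega) {h, a}]
    · rw [Finset.sum_pair (by omega), hhs, hac]; simp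
    · intro x hx
      simp at hx
      rcases hx with rfl | rfl <;> assumption
    · simp; omega
    · intro l hl hl0
      have := hall l hl
      simp
      omega
  · intro h1 h2
    rw [d3] at h2
    rw [union_card hn0 hN hord (by omega) {h, a, b}]
    · rw [Finset.sum_insert (by simp; omega), Finset.sum_pair (by omega), hhs, hac, hbc]
      simp; omega
    · intro x hx
      simp at hx
      rcases hx with rfl | rfl | rfl <;> assumption
    · simp; omega
    · intro l hl hl0
      have h3 := hall l hl
      have h4 := d4' l hl
      simp
      omega
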